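/- arXiv:1201.1645 — 3 statements merged into one kernel-verified Lean document; each statement's English description precedes it below -/
import Mathlib

section
/- Every antiautomorphism of sl₂(F) has the form y ↦ M yᵗ M⁻¹: if σ : L → L is an antiautomorphism of the Lie algebra L = sl₂(F), then there exists an invertible matrix M ∈ Mat₂(F) such that y^σ = M yᵗ M⁻¹ for all y ∈ L (where yᵗ denotes the transpose). -/
open Matrix LieAlgebra.SpecialLinear

/-- A trace-zero `2 × 2` matrix `A` whose commutator with some matrix is `k • A`, where
`2 * k ≠ 0`, squares to zero. -/
theorem Matrix.mul_self_eq_zero_of_lie_eq_smul {F : Type*} [Field F]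
    {A C : Matrix (Fin 2) (Fin 2) F} {k : F} (hk : 2 * k ≠ 0) (hA : A.trace = 0)
    (h : A * C - C * A = k • A) : A * A = 0 := by
  have htr : k * (A * A).trace = 0 := by
    rw [← smul_eq_mul, ← trace_smul, ← mul_smul_comm, ← h, mul_sub, trace_sub, sub_eq_zero,
      trace_mul_comm A (A * C), mul_assoc]
  have hd : A 1 1 = -A 0 0 := by
    rw [trace_fin_two] at hA
    linear_combination hA
  have hdet : A 0 0 * A 0 0 + A 0 1 * A 1 0 = 0 := by
    refine (mul_eq_zero.mp ?_).resolve_left hk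
    simp only [trace_fin_two, mul_apply, Fin.sum_univ_two, hd] at htr
    linear_combination htr
  ext i j
  fin_cases i <;> fin_cases j <;>
    simp only [mul_apply, Fin.sum_univ_two, hd, Fin.zero_eta, Fin.mk_one, zero_apply]
  · exact hdet
  · ring
  · ring
  · linear_combination hdet

/-- Square-zero `2 × 2` matrices `A ≠ 0` and `B` with `A * B * A = A` are simultaneously conjugate to
the standard nilpotent matrices. -/
theorem Matrix.exists_isUnit_mul_eq_mul_single {F : Type*} [Field F]
    {A B : Matrix (Fin 2) (Fin 2) F} (hA0 : A ≠ 0) (hA : A * A = 0) (hB : B * B = 0)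
    (hABA : A * B * A = A) :
    ∃ M : Matrix (Fin 2) (Fin 2) F, IsUnit M ∧
      A * M = M * !![0, 0; 1, 0] ∧ B * M = M * !![0, 1; 0, 0] := by
  obtain ⟨v, hv⟩ : ∃ v, A *ᵥ v ≠ 0 := by
    by_contra! h
    exact hA0 (ext_of_mulVec_single fun i => by simp only [h, zero_mulVec])
  set q := A *ᵥ v with hq
  set p := B *ᵥ q with hp
  have hAp : A *ᵥ p = q := by rw [hp, hq, mulVec_mulVec, mulVec_mulVec, hABA]
  have hAq : A *ᵥ q = 0 := by rw [hq, mulVec_mulVec, hA, zero_mulVec]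
  have hBp : B *ᵥ p = 0 := by rw [hp, mulVec_mulVec, hB, zero_mulVec]
  refine ⟨(of ![p, q])ᵀ, ?_, ?_, ?_⟩
  · rw [isUnit_iff_isUnit_det, isUnit_iff_ne_zero]
    intro hdet
    obtain ⟨x, hx0, hx⟩ := exists_mulVec_eq_zero_iff.mpr hdet
    have hx' : x 0 • p + x 1 • q = 0 := by
      rw [← hx]
      ext i
      simp [mulVec, dotProduct, Fin.sum_univ_two, mul_comm]
    have h0 : x 0 = 0 := by
      have := congrArg (A *ᵥ ·) hx'
      simpa [mulVec_add, mulVec_smul, hAp, hAq, hv] using this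
    have h1 : x 1 = 0 := by simpa [h0, hv] using hx'
    exact hx0 (by ext i; fin_cases i <;> assumption)
  · ext i j
    have h1 := congrFun hAp i
    have h2 := congrFun hAq i
    simp only [mulVec, dotProduct, Fin.sum_univ_two, Pi.zero_apply] at h1 h2
    fin_cases j <;> simp [mul_apply, Fin.sum_univ_two, h1, h2]
  · ext i j
    have h1 := congrFun hBp i
    have h2 := congrFun hp.symm i
    simp only [mulVec, dotProduct, Fin.sum_univ_two, Pi.zero_apply] at h1 h2
    fin_cases j <;> simp [mul_apply, Fin.sum_univ_two, h1, h2]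

/-- Every antiautomorphism of `sl₂(F)` has the form `y ↦ M yᵗ M⁻¹`: if `σ` is an
antiautomorphism of the Lie algebra `L = sl₂(F)` (an `F`-linear bijection with
`σ ⁅y,z⁆ = ⁅σ z, σ y⁆`), then there is an invertible matrix `M ∈ Mat₂(F)` with
`σ y = M yᵗ M⁻¹` for all `y ∈ L`. -/
theorem stmt1 (F : Type*) [Field F] [IsAlgClosed F] (hchar : (2 : F) ≠ 0)
    (σ : sl (Fin 2) F ≃ₗ[F] sl (Fin 2) F)
    (hσ : ∀ y z : sl (Fin 2) F, σ ⁅y, z⁆ = ⁅σ z, σ y⁆) :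
    ∃ M : Matrix (Fin 2) (Fin 2) F, IsUnit M ∧
      ∀ y : sl (Fin 2) F,
        ((σ y : Matrix (Fin 2) (Fin 2) F)) = M * (y : Matrix (Fin 2) (Fin 2) F)ᵀ * M⁻¹ := by
  have htr (y : sl (Fin 2) F) : (y : Matrix (Fin 2) (Fin 2) F).trace = 0 := y.2
  have hmem (X : Matrix (Fin 2) (Fin 2) F) (hX : X.trace = 0) : X ∈ sl (Fin 2) F := hX
  have hmul (y z : sl (Fin 2) F) : (σ ⁅y, z⁆ : Matrix (Fin 2) (Fin 2) F) =
      (σ z : Matrix (Fin 2) (Fin 2) F) * (σ y : Matrix (Fin 2) (Fin 2) F) -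
        (σ y : Matrix (Fin 2) (Fin 2) F) * (σ z : Matrix (Fin 2) (Fin 2) F) := by
    rw [hσ, sl_bracket]
  let e : sl (Fin 2) F := ⟨!![0, 1; 0, 0], hmem _ (by simp [trace_fin_two])⟩
  let f : sl (Fin 2) F := ⟨!![0, 0; 1, 0], hmem _ (by simp [trace_fin_two])⟩
  let h : sl (Fin 2) F := ⟨!![1, 0; 0, -1], hmem _ (by simp [trace_fin_two])⟩
  have hef : ⁅e, f⁆ = h := by
    apply Subtype.ext
    rw [sl_bracket]
    ext i j
    fin_cases i <;> fin_cases j <;> simp [e, f, h]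
  have hhe : ⁅h, e⁆ = (2 : F) • e := by
    apply Subtype.ext
    rw [sl_bracket]
    ext i j
    fin_cases i <;> fin_cases j <;> simp [e, h]
    norm_num
  have hhf : ⁅h, f⁆ = (-2 : F) • f := by
    apply Subtype.ext
    rw [sl_bracket]
    ext i j
    fin_cases i <;> fin_cases j <;> simp [f, h]
    norm_num
  have hC := hmul e f
  have hAC := hmul h e
  have hBC := hmul h f
  rw [hef] at hC
  rw [hhe, map_smul, SetLike.val_smul] at hAC
  rw [hhf, map_smul, SetLike.val_smul] at hBC
  have hA2 := mul_self_eq_zero_of_lie_eq_smul (k := 2) (mul_ne_zero hchar hchar) (htr (σ e)) hAC.symm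
  have hB2 := mul_self_eq_zero_of_lie_eq_smul (k := -2) (mul_ne_zero hchar (neg_ne_zero.mpr hchar))
    (htr (σ f)) hBC.symm
  have hA0 : (σ e : Matrix (Fin 2) (Fin 2) F) ≠ 0 := by
    intro h0
    have he : e = 0 := σ.map_eq_zero_iff.mp (Subtype.ext h0)
    have := congrFun₂ (congrArg Subtype.val he) 0 1
    simp [e] at this
  have hdecomp (y : sl (Fin 2) F) : y = y.1 0 1 • e + y.1 1 0 • f + y.1 0 0 • h := by
    have hy := htr y
    rw [trace_fin_two] at hy
    apply Subtype.ext
    ext i j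
    fin_cases i <;> fin_cases j <;> simp [e, f, h]
    linear_combination hy
  have hσdecomp (y : sl (Fin 2) F) : (σ y : Matrix (Fin 2) (Fin 2) F) =
      y.1 0 1 • (σ e).1 + y.1 1 0 • (σ f).1 + y.1 0 0 • (σ h).1 := by
    conv_lhs => rw [hdecomp y, map_add, map_add, map_smul, map_smul, map_smul]
    rfl
  generalize (σ e : Matrix (Fin 2) (Fin 2) F) = A at *
  generalize (σ f : Matrix (Fin 2) (Fin 2) F) = B at *
  have hABA : A * B * A = A := by
    refine smul_right_injective _ hchar ?_
    change (2 : F) • (A * B * A) = (2 : F) • A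
    rw [hAC, hC, mul_sub, sub_mul, ← mul_assoc, ← mul_assoc, hA2, zero_mul, mul_assoc B, hA2,
      mul_zero, two_smul]
    abel
  obtain ⟨M, hM, hAM, hBM⟩ := exists_isUnit_mul_eq_mul_single hA0 hA2 hB2 hABA
  refine ⟨M, hM, fun y => ?_⟩
  have hCM : (σ h).1 * M = M * !![1, 0; 0, -1] := by
    rw [hC, sub_mul, mul_assoc, mul_assoc, hAM, hBM, ← mul_assoc, ← mul_assoc, hAM, hBM, mul_assoc,
      mul_assoc, ← mul_sub]
    congr 1
    ext i j
    fin_cases i <;> fin_cases j <;> simp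
  have key : (σ y).1 * M = M * y.1ᵀ := by
    rw [hσdecomp, add_mul, add_mul, smul_mul_assoc, smul_mul_assoc, smul_mul_assoc, hAM, hBM, hCM,
      ← mul_smul_comm, ← mul_smul_comm, ← mul_smul_comm, ← mul_add, ← mul_add]
    congr 1
    have hy := htr y
    rw [trace_fin_two] at hy
    ext i j
    fin_cases i <;> fin_cases j <;> simp
    linear_combination -hy
  rw [← key, mul_nonsing_inv_cancel_right _ _ ((isUnit_iff_isUnit_det M).mp hM)]
end

section
/- Let a, a* and b, b* each be a pair of normalized semisimple elements of L = sl₂(F), and suppose each pair generates L as a Lie algebra. Then the following are equivalent: (i) ⟨a,a*⟩ = ⟨b,b*⟩; (ii) there exists an automorphism of L that sends a ↦ b and a* ↦ b*. -/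
open Matrix LieAlgebra.SpecialLinear

/-- An endomorphism of a vector space is diagonalizable when its eigenspaces span. -/
def IsDiagonalizable {F M : Type*} [Field F] [AddCommGroup M] [Module F M]
    (f : Module.End F M) : Prop :=
  (⨆ μ : F, f.eigenspace μ) = ⊤

/-- The bilinear form `⟨y,z⟩ = tr(yz)/2` on `2×2` matrices (one eighth of the Killing form
of `sl₂`). -/
noncomputable def slForm {F : Type*} [Field F]
    (y z : Matrix (Fin 2) (Fin 2) F) : F :=
  Matrix.trace (y * z) / 2

open Module

/-- The trace identity `[x,[x,y]] = 4⟨x,x⟩y - 4⟨x,y⟩x` in `sl₂`. -/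
lemma sl_two_lie_lie {F : Type*} [Field F] (hchar : (2 : F) ≠ 0) (x y : sl (Fin 2) F) :
    ⁅x, ⁅x, y⁆⁆ = (4 * slForm x.1 x.1) • y - (4 * slForm x.1 y.1) • x := by
  obtain ⟨x, hx⟩ := x
  obtain ⟨y, hy⟩ := y
  have htx : x 1 1 = -x 0 0 := by
    have h : x.trace = 0 := hx
    rw [Matrix.trace_fin_two] at h
    linear_combination h
  have hty : y 1 1 = -y 0 0 := by
    have h : y.trace = 0 := hy
    rw [Matrix.trace_fin_two] at h
    linear_combination h
  have hdiv (t : F) : 4 * (t / 2) = 2 * t := by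
    field_simp
    ring
  apply Subtype.ext
  change ⁅x, ⁅x, y⁆⁆ = (4 * slForm x x) • y - (4 * slForm x y) • x
  simp only [slForm, hdiv, Ring.lie_def, Matrix.trace_fin_two]
  ext i j
  fin_cases i <;> fin_cases j <;>
    simp [Matrix.mul_apply, Fin.sum_univ_two, htx, hty] <;> ring

lemma slForm_comm {F : Type*} [Field F] (x y : Matrix (Fin 2) (Fin 2) F) :
    slForm x y = slForm y x := by
  rw [slForm, slForm, Matrix.trace_mul_comm]

lemma finrank_sl_two (F : Type*) [Field F] : finrank F (sl (Fin 2) F) = 3 := by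
  have h := (Matrix.traceLinearMap (Fin 2) F F).finrank_range_add_finrank_ker
  have hsurj : Function.Surjective (Matrix.traceLinearMap (Fin 2) F F) := fun c =>
    ⟨!![c, 0; 0, 0], by simp [Matrix.trace_fin_two]⟩
  rw [LinearMap.range_eq_top.mpr hsurj, finrank_top, finrank_self, finrank_matrix] at h
  have hker : finrank F (sl (Fin 2) F) =
      finrank F (LinearMap.ker (Matrix.traceLinearMap (Fin 2) F F)) := rfl
  simp at h
  omega

section Triple

variable {F L : Type*} [Field F] [LieRing L] [LieAlgebra F L]

/-- The bracket of two linear combinations of `x, y, [x,y]`, when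
`[x,[x,y]] = 4y - 4cx` and `[y,[y,x]] = 4x - 4cy`. -/
lemma lie_triple_combination {x y : L} {c : F}
    (hx : ⁅x, ⁅x, y⁆⁆ = (4 : F) • y - (4 * c) • x)
    (hy : ⁅y, ⁅y, x⁆⁆ = (4 : F) • x - (4 * c) • y) (p q r s t u : F) :
    ⁅p • x + q • y + r • ⁅x, y⁆, s • x + t • y + u • ⁅x, y⁆⁆ =
      (-4 * c * (p * u - r * s) - 4 * (q * u - r * t)) • x +
        (4 * (p * u - r * s) + 4 * c * (q * u - r * t)) • y + (p * t - q * s) • ⁅x, y⁆ := by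
  have hy' : ⁅y, ⁅x, y⁆⁆ = (4 * c) • y - (4 : F) • x := by
    rw [← lie_skew x y, lie_neg, hy, neg_sub]
  have hzx : ⁅⁅x, y⁆, x⁆ = -⁅x, ⁅x, y⁆⁆ := (lie_skew _ _).symm
  have hzy : ⁅⁅x, y⁆, y⁆ = -⁅y, ⁅x, y⁆⁆ := (lie_skew _ _).symm
  have hyx : ⁅y, x⁆ = -⁅x, y⁆ := (lie_skew _ _).symm
  simp only [add_lie, lie_add, smul_lie, lie_smul, lie_self, hzx, hzy, hyx, hx, hy']
  module

/-- Under the same relations, if `x, y` generate `L` then `x, y, [x,y]` span `L`. -/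
lemma span_triple_eq_top {x y : L} {c : F}
    (hx : ⁅x, ⁅x, y⁆⁆ = (4 : F) • y - (4 * c) • x)
    (hy : ⁅y, ⁅y, x⁆⁆ = (4 : F) • x - (4 * c) • y)
    (hgen : LieSubalgebra.lieSpan F L {x, y} = ⊤) :
    Submodule.span F {x, y, ⁅x, y⁆} = ⊤ := by
  let K : LieSubalgebra F L :=
    { Submodule.span F {x, y, ⁅x, y⁆} with
      lie_mem' := by
        intro v w hv hw
        obtain ⟨p, q, r, rfl⟩ := Submodule.mem_span_triple.mp hv
        obtain ⟨s, t, u, rfl⟩ := Submodule.mem_span_triple.mp hw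
        exact Submodule.mem_span_triple.mpr
          ⟨_, _, _, (lie_triple_combination hx hy p q r s t u).symm⟩ }
  have hK : LieSubalgebra.lieSpan F L {x, y} ≤ K := by
    rw [LieSubalgebra.lieSpan_le]
    rintro v (rfl | rfl) <;> exact Submodule.subset_span (by simp)
  rw [hgen] at hK
  exact eq_top_iff.mpr fun v _ => hK (LieSubalgebra.mem_top v)

/-- In dimension three, two generating pairs satisfying the same relations are related by an
automorphism. -/
lemma exists_lie_automorphism (hdim : finrank F L = 3) {x y x' y' : L} {c : F}
    (hx : ⁅x, ⁅x, y⁆⁆ = (4 : F) • y - (4 * c) • x)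
    (hy : ⁅y, ⁅y, x⁆⁆ = (4 : F) • x - (4 * c) • y)
    (hx' : ⁅x', ⁅x', y'⁆⁆ = (4 : F) • y' - (4 * c) • x')
    (hy' : ⁅y', ⁅y', x'⁆⁆ = (4 : F) • x' - (4 * c) • y')
    (hgen : LieSubalgebra.lieSpan F L {x, y} = ⊤)
    (hgen' : LieSubalgebra.lieSpan F L {x', y'} = ⊤) :
    ∃ σ : L ≃ₗ[F] L, (∀ u v : L, σ ⁅u, v⁆ = ⁅σ u, σ v⁆) ∧ σ x = x' ∧ σ y = y' := by
  have hspan := span_triple_eq_top hx hy hgen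
  have hspan' := span_triple_eq_top hx' hy' hgen'
  let B := basisOfTopLeSpanOfCardEqFinrank (R := F) ![x, y, ⁅x, y⁆]
    (by simp only [Matrix.range_cons, Matrix.range_empty, Set.union_empty, Set.singleton_union,
      hspan, le_refl]) (by simp [hdim])
  let B' := basisOfTopLeSpanOfCardEqFinrank (R := F) ![x', y', ⁅x', y'⁆]
    (by simp only [Matrix.range_cons, Matrix.range_empty, Set.union_empty, Set.singleton_union,
      hspan', le_refl]) (by simp [hdim])
  let σ := B.equiv B' (Equiv.refl _)
  have hσ (i : Fin 3) : σ (![x, y, ⁅x, y⁆] i) = ![x', y', ⁅x', y'⁆] i := by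
    simpa [B, B'] using B.equiv_apply i B' (Equiv.refl _)
  have hσx : σ x = x' := hσ 0
  have hσy : σ y = y' := hσ 1
  have hσz : σ ⁅x, y⁆ = ⁅x', y'⁆ := hσ 2
  refine ⟨σ, fun v w => ?_, hσx, hσy⟩
  obtain ⟨p, q, r, rfl⟩ := Submodule.mem_span_triple.mp (hspan ▸ Submodule.mem_top : v ∈ _)
  obtain ⟨s, t, u, rfl⟩ := Submodule.mem_span_triple.mp (hspan ▸ Submodule.mem_top : w ∈ _)
  rw [lie_triple_combination hx hy]
  simp only [map_add, map_smul, hσx, hσy, hσz]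
  rw [lie_triple_combination hx' hy']

end Triple

/-- Let `a, a*` and `b, b*` be pairs of normalized semisimple elements of `L = sl₂(F)`,
each pair generating `L` as a Lie algebra.  The following are equivalent:
(i) `⟨a,a*⟩ = ⟨b,b*⟩`;
(ii) there is an automorphism of `L` sending `a ↦ b` and `a* ↦ b*`. -/
theorem stmt7 (F : Type*) [Field F] [IsAlgClosed F] (hchar : (2 : F) ≠ 0)
    (a as b bs : sl (Fin 2) F)
    (ha : IsDiagonalizable (LieAlgebra.ad F (sl (Fin 2) F) a))
    (has : IsDiagonalizable (LieAlgebra.ad F (sl (Fin 2) F) as))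
    (hb : IsDiagonalizable (LieAlgebra.ad F (sl (Fin 2) F) b))
    (hbs : IsDiagonalizable (LieAlgebra.ad F (sl (Fin 2) F) bs))
    (hna : slForm (a : Matrix (Fin 2) (Fin 2) F) (a : Matrix (Fin 2) (Fin 2) F) = 1)
    (hnas : slForm (as : Matrix (Fin 2) (Fin 2) F) (as : Matrix (Fin 2) (Fin 2) F) = 1)
    (hnb : slForm (b : Matrix (Fin 2) (Fin 2) F) (b : Matrix (Fin 2) (Fin 2) F) = 1)
    (hnbs : slForm (bs : Matrix (Fin 2) (Fin 2) F) (bs : Matrix (Fin 2) (Fin 2) F) = 1)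
    (hgen1 : LieSubalgebra.lieSpan F (sl (Fin 2) F) {a, as} = ⊤)
    (hgen2 : LieSubalgebra.lieSpan F (sl (Fin 2) F) {b, bs} = ⊤) :
    slForm (a : Matrix (Fin 2) (Fin 2) F) (as : Matrix (Fin 2) (Fin 2) F) =
      slForm (b : Matrix (Fin 2) (Fin 2) F) (bs : Matrix (Fin 2) (Fin 2) F) ↔
    ∃ σ : sl (Fin 2) F ≃ₗ[F] sl (Fin 2) F,
      (∀ u v : sl (Fin 2) F, σ ⁅u, v⁆ = ⁅σ u, σ v⁆) ∧ σ a = b ∧ σ as = bs := by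
  have four_ne : (4 : F) ≠ 0 := by
    have h : (4 : F) = 2 * 2 := by norm_num
    rw [h]
    exact mul_ne_zero hchar hchar
  have relation {x : sl (Fin 2) F} (hx : slForm x.1 x.1 = 1) (y : sl (Fin 2) F) :
      ⁅x, ⁅x, y⁆⁆ = (4 : F) • y - (4 * slForm x.1 y.1) • x := by
    rw [sl_two_lie_lie hchar, hx, mul_one]
  constructor
  · intro h
    refine exists_lie_automorphism (finrank_sl_two F) (relation hna as) ?_ ?_ ?_ hgen1 hgen2
    · rw [slForm_comm a.1]
      exact relation hnas a
    · rw [h]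
      exact relation hnb bs
    · rw [h, slForm_comm b.1]
      exact relation hnbs b
  · rintro ⟨σ, hσ, rfl, rfl⟩
    have hb0 : σ a ≠ 0 := by
      intro h0
      rw [h0] at hnb
      simp [slForm] at hnb
    have h := congrArg σ (relation hna as)
    rw [hσ, hσ, relation hnb, map_sub, map_smul, map_smul, sub_right_inj] at h
    exact (mul_left_cancel₀ four_ne (smul_left_injective F hb0 h)).symm
end

section
/- (Krawtchouk orthogonality, dual form) For all i, j ∈ {0,1,…,N}: Σ_{n=0}^{N} K_n(i)·K_n(j)·C(N,n)·pⁿ·(1−p)^{N−n} = δ_{i,j}·C(N,i)⁻¹·((1−p)/p)^i, where δ_{i,j} is the Kronecker delta and C(N,i) is invertible in F by feasibility of N. -/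
open Finset

/-- The Krawtchouk polynomial value
`K_i(j) = Σ_{n=0}^{N} (−i)_n (−j)_n / ((−N)_n · n! · pⁿ)`, computed in the field `F`,
where `(α)_n` is the shifted factorial (ascending Pochhammer symbol). -/
noncomputable def kraw (F : Type*) [Field F] (p : F) (N i j : ℕ) : F :=
  ∑ n ∈ Finset.range (N + 1),
    ((ascPochhammer F n).eval (-(i : F)) * (ascPochhammer F n).eval (-(j : F))) /
      ((ascPochhammer F n).eval (-(N : F)) * (n.factorial : F) * p ^ n)

/-- Generating polynomial of the numbers `C(N,i) K_n(i)`, `0 ≤ i ≤ N`. -/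
noncomputable def krawGen (F : Type*) [Field F] (p : F) (N n : ℕ) : Polynomial F :=
  (1 + Polynomial.X) ^ (N - n) * (1 - Polynomial.C ((1 - p) / p) * Polynomial.X) ^ n

theorem natCast_choose_ne_zero {F : Type*} [Field F] {N k : ℕ} (hN : (N.factorial : F) ≠ 0)
    (hk : k ≤ N) : (N.choose k : F) ≠ 0 := by
  intro h
  apply hN
  rw [← Nat.choose_mul_factorial_mul_factorial hk]
  push_cast
  rw [h]
  ring

theorem natCast_factorial_ne_zero_of_le {F : Type*} [Field F] {N k : ℕ}
    (hN : (N.factorial : F) ≠ 0) (hk : k ≤ N) : (k.factorial : F) ≠ 0 := by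
  intro h
  apply hN
  rw [← Nat.choose_mul_factorial_mul_factorial hk]
  push_cast
  rw [h]
  ring

theorem ascPochhammer_eval_neg_natCast (F : Type*) [Field F] (m k : ℕ) :
    (ascPochhammer F k).eval (-(m : F)) = (-1) ^ k * (k.factorial * m.choose k) := by
  rw [ascPochhammer_eval_neg_eq_descPochhammer, descPochhammer_eval_eq_descFactorial,
    Nat.descFactorial_eq_factorial_mul_choose]
  push_cast
  rfl

theorem kraw_eq_sum_choose {F : Type*} [Field F] {N : ℕ} (hN : (N.factorial : F) ≠ 0)
    {p : F} (hp0 : p ≠ 0) (n i : ℕ) :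
    kraw F p N n i =
      ∑ k ∈ range (N + 1), (-1 / p) ^ k * n.choose k * i.choose k / N.choose k := by
  refine sum_congr rfl fun k hk => ?_
  have hkN : k ≤ N := by simpa [Nat.lt_succ_iff] using hk
  have h1 := natCast_choose_ne_zero hN hkN
  have h2 := natCast_factorial_ne_zero_of_le hN hkN
  have h3 : ((-1 : F)) ^ k ≠ 0 := pow_ne_zero _ (by simp)
  simp only [ascPochhammer_eval_neg_natCast, div_pow]
  field_simp

theorem krawGen_eq_sum {F : Type*} [Field F] {p : F} (hp0 : p ≠ 0) {N n : ℕ} (hn : n ≤ N) :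
    krawGen F p N n = ∑ k ∈ range (N + 1), Polynomial.C ((-1 / p) ^ k * n.choose k) *
      (Polynomial.X ^ k * (1 + Polynomial.X) ^ (N - k)) := by
  have hbase : (1 - Polynomial.C ((1 - p) / p) * Polynomial.X : Polynomial F) =
      Polynomial.C (-1 / p) * Polynomial.X + (1 + Polynomial.X) := by
    have : (1 - p) / p = -(-1 / p) - 1 := by field_simp
    rw [this]
    simp only [map_sub, map_neg, map_one]
    ring
  have hsub : range (n + 1) ⊆ range (N + 1) := range_subset_range.2 (by omega)
  rw [krawGen, hbase, add_pow _ _ n, mul_sum, ← sum_subset hsub]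
  · refine sum_congr rfl fun k hk => ?_
    have hkn : k ≤ n := by simpa [Nat.lt_succ_iff] using hk
    have hexp : N - k = (N - n) + (n - k) := by omega
    rw [hexp, pow_add]
    simp only [map_mul, map_pow, map_natCast, mul_pow]
    ring
  · intro k _ hk
    have : n < k := by simpa [Nat.lt_succ_iff] using hk
    simp [Nat.choose_eq_zero_of_lt this]

theorem krawGen_coeff {F : Type*} [Field F] {N : ℕ} (hN : (N.factorial : F) ≠ 0)
    {p : F} (hp0 : p ≠ 0) {n : ℕ} (hn : n ≤ N) (i : ℕ) :
    (krawGen F p N n).coeff i = N.choose i * kraw F p N n i := by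
  rw [krawGen_eq_sum hp0 hn, kraw_eq_sum_choose hN hp0, Polynomial.finsetSum_coeff, mul_sum]
  refine sum_congr rfl fun k hk => ?_
  have hkN : k ≤ N := by simpa [Nat.lt_succ_iff] using hk
  have h1 := natCast_choose_ne_zero hN hkN
  rw [Polynomial.coeff_C_mul, Polynomial.coeff_X_pow_mul', Polynomial.coeff_one_add_X_pow]
  split_ifs with hki
  · have h : (N.choose i * i.choose k : F) = N.choose k * (N - k).choose (i - k) := by
      rw [← Nat.cast_mul, ← Nat.cast_mul, Nat.choose_mul hki]
    rw [eq_comm, ← mul_div_assoc, div_eq_iff h1]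
    linear_combination (-1 / p) ^ k * n.choose k * h
  · simp [Nat.choose_eq_zero_of_lt (not_le.1 hki)]

theorem sum_krawGen_mul_map {F : Type*} [Field F] {p : F} (hp0 : p ≠ 0) (N : ℕ) :
    ∑ n ∈ range (N + 1), Polynomial.C (Polynomial.C (N.choose n * p ^ n * (1 - p) ^ (N - n))) *
        (Polynomial.C (krawGen F p N n) * (krawGen F p N n).map Polynomial.C) =
      ((1 + Polynomial.X) ^ N).comp
        (Polynomial.C (Polynomial.C ((1 - p) / p) * Polynomial.X) * Polynomial.X) := by
  set r := (1 - p) / p with hr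
  have hq : 1 - p = r * p := by rw [hr]; field_simp
  have hp : (Polynomial.C (Polynomial.C (r * p)) + Polynomial.C (Polynomial.C p) :
      Polynomial (Polynomial F)) = 1 := by
    rw [← map_add, ← map_add, ← hq]
    simp
  have hbase : (1 + Polynomial.C (Polynomial.C r * Polynomial.X) * Polynomial.X :
      Polynomial (Polynomial F)) =
      Polynomial.C (Polynomial.C p) * ((1 - Polynomial.C (Polynomial.C r * Polynomial.X)) *
        (1 - Polynomial.C (Polynomial.C r) * Polynomial.X)) +
      Polynomial.C (Polynomial.C (r * p)) *
        ((1 + Polynomial.C Polynomial.X) * (1 + Polynomial.X)) := by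
    simp only [map_mul] at hp ⊢
    linear_combination (-1 - Polynomial.C (Polynomial.C r) * Polynomial.C Polynomial.X *
      Polynomial.X) * hp
  simp only [Polynomial.pow_comp, Polynomial.add_comp, Polynomial.one_comp, Polynomial.X_comp]
  rw [hbase, add_pow]
  refine sum_congr rfl fun n _ => ?_
  rw [hq, krawGen, ← hr]
  simp only [map_mul, map_pow, map_add, map_sub, map_one, map_natCast, Polynomial.map_mul,
    Polynomial.map_pow, Polynomial.map_add, Polynomial.map_sub, Polynomial.map_one,
    Polynomial.map_C, Polynomial.map_X, mul_pow]
  ring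

/-- Krawtchouk orthogonality (dual form): for `0 ≤ i, j ≤ N`,
`Σ_{n=0}^{N} K_n(i) K_n(j) C(N,n) pⁿ (1−p)^{N−n} = δ_{ij} C(N,i)⁻¹ ((1−p)/p)^i`.
Feasibility of `N` is encoded by `(N! : F) ≠ 0`. -/
theorem stmt11 (F : Type*) [Field F] (hchar : (2 : F) ≠ 0)
    (N : ℕ) (hN : (N.factorial : F) ≠ 0)
    (p : F) (hp0 : p ≠ 0) (hp1 : p ≠ 1)
    (i j : ℕ) (hi : i ≤ N) (hj : j ≤ N) :
    ∑ n ∈ Finset.range (N + 1),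
        kraw F p N n i * kraw F p N n j * (N.choose n : F) * p ^ n * (1 - p) ^ (N - n)
      = (if i = j then 1 else 0) * ((N.choose i : F))⁻¹ * ((1 - p) / p) ^ i := by
  have hci := natCast_choose_ne_zero hN hi
  have hcj := natCast_choose_ne_zero hN hj
  have h := congrArg (fun f => (f.coeff j).coeff i) (sum_krawGen_mul_map hp0 N)
  simp only [Polynomial.finsetSum_coeff, Polynomial.coeff_C_mul, Polynomial.coeff_map,
    Polynomial.coeff_mul_C, Polynomial.comp_C_mul_X_coeff, Polynomial.coeff_one_add_X_pow,
    mul_pow, ← Polynomial.C_pow, ← Polynomial.C_eq_natCast, Polynomial.coeff_X_pow] at h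
  apply mul_left_cancel₀ (mul_ne_zero hci hcj)
  calc _ = ∑ n ∈ range (N + 1), N.choose n * p ^ n * (1 - p) ^ (N - n) *
        ((krawGen F p N n).coeff i * (krawGen F p N n).coeff j) := by
        rw [mul_sum]
        refine sum_congr rfl fun n hn => ?_
        have hnN : n ≤ N := by simpa [Nat.lt_succ_iff] using hn
        rw [krawGen_coeff hN hp0 hnN i, krawGen_coeff hN hp0 hnN j]
        ring
    _ = _ := by
        rw [h]
        split_ifs with hij
        · subst hij
          field_simp
        · simp
end
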